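/- arXiv:2509.07854 — 8 statements merged into one kernel-verified Lean document; each statement's English description precedes it below -/
import Mathlib

section
/- For the path graph P_n on n ≥ 2 vertices, the 1-fault tolerant zero forcing number satisfies Z_t(P_n) = 2. -/
open SimpleGraph

/-- One simultaneous application of the zero forcing color change rule:
a blue vertex `b` forces its unique white neighbor to become blue. -/
def zfStep {V : Type*} (G : SimpleGraph V) (B : Set V) : Set V :=
  B ∪ {w | ∃ b ∈ B, G.Adj b w ∧ ∀ w', G.Adj b w' → w' ∉ B → w' = w}

/-- `B` is a zero forcing set if iterating the color change rule eventually
colors every vertex blue. -/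
def IsZeroForcingSet {V : Type*} (G : SimpleGraph V) (B : Set V) : Prop :=
  ∃ n : ℕ, (zfStep G)^[n] B = Set.univ

/-- The zero forcing number `Z(G)`. -/
noncomputable def zeroForcingNumber {V : Type*} (G : SimpleGraph V) : ℕ :=
  sInf {m | ∃ B : Set V, IsZeroForcingSet G B ∧ B.ncard = m}

/-- `B` is a `k`-fault tolerant zero forcing set: every subset of `B` of
cardinality `|B| - k` is a zero forcing set. -/
def IsFaultTolerant {V : Type*} (G : SimpleGraph V) (k : ℕ) (B : Set V) : Prop :=
  ∀ F ⊆ B, F.ncard = B.ncard - k → IsZeroForcingSet G F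

/-- The `k`-fault tolerant zero forcing number `Z_t^k(G)`. -/
noncomputable def ftZeroForcingNumber {V : Type*} (G : SimpleGraph V) (k : ℕ) : ℕ :=
  sInf {m | ∃ B : Set V, IsFaultTolerant G k B ∧ B.ncard = m}

theorem zfStep_iterate_empty {V : Type*} (G : SimpleGraph V) (k : ℕ) :
    (zfStep G)^[k] ∅ = ∅ :=
  Function.iterate_fixed (by simp [zfStep]) k

theorem not_isZeroForcingSet_empty {V : Type*} [Nonempty V] (G : SimpleGraph V) :
    ¬ IsZeroForcingSet G ∅ := by
  rintro ⟨k, hk⟩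
  rw [zfStep_iterate_empty] at hk
  exact Set.empty_ne_univ hk

/-- A fault tolerant set has more than `k` elements. -/
theorem IsFaultTolerant.lt_ncard {V : Type*} [Nonempty V] {G : SimpleGraph V} {k : ℕ}
    {B : Set V} (hB : IsFaultTolerant G k B) : k < B.ncard := by
  by_contra! h
  refine not_isZeroForcingSet_empty G (hB ∅ (Set.empty_subset B) ?_)
  rw [Set.ncard_empty, Nat.sub_eq_zero_of_le h]

theorem mem_zfStep_iterate_of_first {n : ℕ} {B : Set (Fin n)}
    (hB : ∀ i : Fin n, i.val = 0 → i ∈ B) (k : ℕ) (i : Fin n) (hi : i.val ≤ k) :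
    i ∈ (zfStep (pathGraph n))^[k] B := by
  induction k generalizing i with
  | zero => exact hB i (by omega)
  | succ k ih =>
    rw [Function.iterate_succ_apply']
    rcases Nat.lt_or_ge k i.val with h | h
    · refine Or.inr ⟨⟨k, by omega⟩, ih _ le_rfl, ?_, fun w hw hwB => ?_⟩
      · rw [pathGraph_adj]
        exact Or.inl (show k + 1 = i.val by omega)
      · have hk : k < w.val := lt_of_not_ge fun h => hwB (ih w h)
        rw [pathGraph_adj] at hw
        dsimp only at hw
        exact Fin.ext (by omega)
    · exact Or.inl (ih i h)

theorem mem_zfStep_iterate_of_last {n : ℕ} {B : Set (Fin n)}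
    (hB : ∀ i : Fin n, i.val + 1 = n → i ∈ B) (k : ℕ) (i : Fin n) (hi : n ≤ i.val + 1 + k) :
    i ∈ (zfStep (pathGraph n))^[k] B := by
  induction k generalizing i with
  | zero => exact hB i (by omega)
  | succ k ih =>
    rw [Function.iterate_succ_apply']
    rcases Nat.lt_or_ge (i.val + 1 + k) n with h | h
    · refine Or.inr ⟨⟨i.val + 1, by omega⟩, ih _ (by dsimp only; omega), ?_,
        fun w hw hwB => ?_⟩
      · rw [pathGraph_adj]
        exact Or.inr rfl
      · have hk : w.val + 1 + k < n := lt_of_not_ge fun h => hwB (ih w h)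
        rw [pathGraph_adj] at hw
        dsimp only at hw
        exact Fin.ext (by omega)
    · exact Or.inl (ih i h)

theorem isFaultTolerant_pathGraph_endpoints {n : ℕ} {a b : Fin n} (ha : a.val = 0)
    (hb : b.val + 1 = n) (hab : a ≠ b) : IsFaultTolerant (pathGraph n) 1 {a, b} := by
  intro F hF hcard
  rw [Set.ncard_pair hab] at hcard
  obtain ⟨x, rfl⟩ := Set.ncard_eq_one.mp hcard
  refine ⟨n, Set.eq_univ_of_forall fun i => ?_⟩
  rcases hF (Set.mem_singleton x) with rfl | rfl
  · exact mem_zfStep_iterate_of_first (fun j hj => Fin.ext (hj.trans ha.symm)) n i i.isLt.le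
  · exact mem_zfStep_iterate_of_last
      (fun j hj => Fin.ext (Nat.succ_injective (hj.trans hb.symm))) n i (by omega)

theorem stmt2 (n : ℕ) (hn : 2 ≤ n) :
    ftZeroForcingNumber (SimpleGraph.pathGraph n) 1 = 2 := by
  have : Nonempty (Fin n) := ⟨⟨0, by omega⟩⟩
  have hne : (⟨0, by omega⟩ : Fin n) ≠ ⟨n - 1, by omega⟩ := by
    rw [Ne, Fin.mk.injEq]
    omega
  refine IsLeast.csInf_eq ⟨⟨_, isFaultTolerant_pathGraph_endpoints rfl ?_ hne,
    Set.ncard_pair hne⟩, ?_⟩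
  · exact Nat.sub_add_cancel (by omega)
  · rintro m ⟨B, hB, rfl⟩
    exact hB.lt_ncard
end

section
/- For the cycle graph C_n on n ≥ 4 vertices, the 1-fault tolerant zero forcing number satisfies Z_t(C_n) = 4. -/
open SimpleGraph

/-- A set that is closed under the color change rule and is not everything is not zero forcing. -/
theorem not_isZeroForcingSet_of_zfStep_eq {V : Type*} {G : SimpleGraph V} {B : Set V}
    (h : zfStep G B = B) (hB : B ≠ Set.univ) : ¬ IsZeroForcingSet G B := by
  rintro ⟨n, hn⟩
  exact hB ((Function.iterate_fixed h n).symm.trans hn)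

/-- In a finite graph, `B` is zero forcing as soon as the only superset of `B` closed under the
color change rule is the whole vertex set. -/
theorem isZeroForcingSet_of_forall_closed {V : Type*} [Finite V] {G : SimpleGraph V} {B : Set V}
    (h : ∀ S, B ⊆ S → zfStep G S = S → S = Set.univ) : IsZeroForcingSet G B := by
  have hmono : Monotone fun k => (zfStep G)^[k] B :=
    monotone_nat_of_le_succ fun k => by
      rw [Function.iterate_succ_apply']
      exact Set.subset_union_left
  obtain ⟨k, hk⟩ := WellFoundedGT.monotone_chain_condition ⟨_, hmono⟩
  refine ⟨k, h _ (hmono (Nat.zero_le k)) ?_⟩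
  exact (Function.iterate_succ_apply' _ _ _).symm.trans (hk (k + 1) (Nat.le_succ k)).symm

section

open scoped Fin.CommRing

theorem cycleGraph_natCast_ne_zero {m k : ℕ} (hk : k ≠ 0) (hkm : k < m + 4) :
    (k : Fin (m + 4)) ≠ 0 := by
  rw [Ne, Fin.natCast_eq_zero]
  exact fun h => hk (Nat.eq_zero_of_dvd_of_lt h hkm)

/-- A set containing two adjacent vertices of a cycle is zero forcing. -/
theorem isZeroForcingSet_cycleGraph_of_mem {m : ℕ} {B : Set (Fin (m + 4))} {a : Fin (m + 4)}
    (h₀ : a ∈ B) (h₁ : a + 1 ∈ B) : IsZeroForcingSet (cycleGraph (m + 4)) B := by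
  refine isZeroForcingSet_of_forall_closed fun S hBS hS => ?_
  have key : ∀ k : ℕ, a + k ∈ S ∧ a + k + 1 ∈ S := by
    intro k
    induction k with
    | zero => simpa using ⟨hBS h₀, hBS h₁⟩
    | succ k ih =>
      have hcast : a + ((k + 1 : ℕ) : Fin (m + 4)) = a + k + 1 := by
        rw [Nat.cast_add, Nat.cast_one, add_assoc]
      rw [hcast]
      refine ⟨ih.2, ?_⟩
      rw [← hS]
      refine Or.inr ⟨a + k + 1, ih.2, ?_, fun w hw hwS => ?_⟩
      · exact cycleGraph_adj.2 (Or.inr (add_sub_cancel_left _ _))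
      · rcases cycleGraph_adj.1 hw with h | h
        · have hw' : w = a + k := by
            rw [sub_eq_iff_eq_add, add_comm 1 w] at h
            exact (add_right_cancel h).symm
          exact absurd (hw' ▸ ih.1) hwS
        · rw [sub_eq_iff_eq_add] at h
          exact h.trans (add_comm _ _)
  refine Set.eq_univ_of_forall fun x => ?_
  have := (key (x - a).val).1
  rwa [Fin.cast_val_eq_self, add_sub_cancel] at this

/-- An independent set of a cycle on at least four vertices is not zero forcing. -/
theorem not_isZeroForcingSet_cycleGraph_of_isIndepSet {m : ℕ} {B : Set (Fin (m + 4))}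
    (hB : ∀ a ∈ B, ∀ b ∈ B, ¬ (cycleGraph (m + 4)).Adj a b) :
    ¬ IsZeroForcingSet (cycleGraph (m + 4)) B := by
  have hsucc (b : Fin (m + 4)) : (cycleGraph (m + 4)).Adj b (b + 1) :=
    cycleGraph_adj.2 (Or.inr (add_sub_cancel_left _ _))
  have hpred (b : Fin (m + 4)) : (cycleGraph (m + 4)).Adj b (b - 1) :=
    cycleGraph_adj.2 (Or.inl (sub_sub_cancel _ _))
  refine not_isZeroForcingSet_of_zfStep_eq (Set.union_eq_self_of_subset_right ?_) ?_
  · rintro w ⟨b, hb, -, hw⟩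
    have h₁ := hw _ (hsucc b) fun h => hB _ hb _ h (hsucc b)
    have h₂ := hw _ (hpred b) fun h => hB _ hb _ h (hpred b)
    have h₃ : ((2 : ℕ) : Fin (m + 4)) = 0 := by
      have h := h₁.trans h₂.symm
      linear_combination h
    exact absurd h₃ (cycleGraph_natCast_ne_zero (by omega) (by omega))
  · rintro rfl
    exact hB 0 trivial _ trivial (hsucc 0)

/-- A cycle on at least four vertices has no triangle. -/
theorem cycleGraph_not_triangle {m : ℕ} {x y z : Fin (m + 4)}
    (hxy : (cycleGraph (m + 4)).Adj x y) (hyz : (cycleGraph (m + 4)).Adj y z)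
    (hxz : (cycleGraph (m + 4)).Adj x z) : False := by
  have h₁ : ((1 : ℕ) : Fin (m + 4)) ≠ 0 := cycleGraph_natCast_ne_zero (by omega) (by omega)
  have h₃ : ((3 : ℕ) : Fin (m + 4)) ≠ 0 := cycleGraph_natCast_ne_zero (by omega) (by omega)
  push_cast at h₁ h₃
  rcases cycleGraph_adj.1 hxy with a | a <;> rcases cycleGraph_adj.1 hyz with b | b <;>
    rcases cycleGraph_adj.1 hxz with c | c <;> grind

theorem isFaultTolerant_cycleGraph (m : ℕ) :
    IsFaultTolerant (cycleGraph (m + 4)) 1 {0, 1, 2, 3} ∧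
      ({0, 1, 2, 3} : Set (Fin (m + 4))).ncard = 4 := by
  have hcard : ({0, 1, 2, 3} : Set (Fin (m + 4))).ncard = 4 := by
    have h₁ : ((1 : ℕ) : Fin (m + 4)) ≠ 0 := cycleGraph_natCast_ne_zero (by omega) (by omega)
    have h₂ : ((2 : ℕ) : Fin (m + 4)) ≠ 0 := cycleGraph_natCast_ne_zero (by omega) (by omega)
    have h₃ : ((3 : ℕ) : Fin (m + 4)) ≠ 0 := cycleGraph_natCast_ne_zero (by omega) (by omega)
    push_cast at h₁ h₂ h₃
    have h₁₂ : (1 : Fin (m + 4)) ≠ 2 := fun h => h₁ (by linear_combination -h)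
    have h₁₃ : (1 : Fin (m + 4)) ≠ 3 := fun h => h₂ (by linear_combination -h)
    have h₂₃ : (2 : Fin (m + 4)) ≠ 3 := fun h => h₁ (by linear_combination -h)
    rw [Set.ncard_insert_of_notMem, Set.ncard_insert_of_notMem, Set.ncard_pair] <;> grind
  refine ⟨fun F hF hFc => ?_, hcard⟩
  rw [hcard] at hFc
  classical
  by_cases h₀₁ : (0 : Fin (m + 4)) ∈ F ∧ 1 ∈ F
  · exact isZeroForcingSet_cycleGraph_of_mem h₀₁.1 (by simpa using h₀₁.2)
  by_cases h₂₃ : (2 : Fin (m + 4)) ∈ F ∧ 3 ∈ F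
  · refine isZeroForcingSet_cycleGraph_of_mem h₂₃.1 ?_
    convert h₂₃.2 using 1
    norm_num
  obtain ⟨x, y, hxy⟩ : ∃ x y, F ⊆ {x, y} := by
    refine ⟨if 0 ∈ F then 0 else 1, if 2 ∈ F then 2 else 3, fun v hv => ?_⟩
    have := hF hv
    simp only [Set.mem_insert_iff, Set.mem_singleton_iff] at this ⊢
    grind
  have := (Set.ncard_le_ncard hxy).trans (Set.ncard_insert_le x {y})
  rw [Set.ncard_singleton] at this
  omega

theorem four_le_ncard_of_isFaultTolerant_cycleGraph {m : ℕ} {B : Set (Fin (m + 4))}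
    (hB : IsFaultTolerant (cycleGraph (m + 4)) 1 B) : 4 ≤ B.ncard := by
  by_contra! hlt
  by_cases hB₃ : B.ncard = 3
  · obtain ⟨x, y, z, hxy, hxz, hyz, rfl⟩ := Set.ncard_eq_three.1 hB₃
    have adj_of_pair {u v : Fin (m + 4)} (huv : u ≠ v)
        (hs : ({u, v} : Set (Fin (m + 4))) ⊆ {x, y, z}) : (cycleGraph (m + 4)).Adj u v := by
      by_contra hn
      refine not_isZeroForcingSet_cycleGraph_of_isIndepSet ?_
        (hB {u, v} hs (by rw [Set.ncard_pair huv, hB₃]))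
      rintro a (rfl | rfl) b (rfl | rfl) h
      exacts [h.ne rfl, hn h, hn h.symm, h.ne rfl]
    exact cycleGraph_not_triangle (adj_of_pair hxy (by grind)) (adj_of_pair hyz (by grind))
      (adj_of_pair hxz (by grind))
  · obtain ⟨F, hF, hFc⟩ := Set.exists_subset_card_eq (Nat.sub_le B.ncard 1)
    refine not_isZeroForcingSet_cycleGraph_of_isIndepSet ?_ (hB F hF hFc)
    intro a ha b hb h
    exact h.ne ((Set.ncard_le_one).1 (by omega) a ha b hb)

end

theorem stmt5 (n : ℕ) (hn : 4 ≤ n) :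
    ftZeroForcingNumber (SimpleGraph.cycleGraph n) 1 = 4 := by
  obtain ⟨m, rfl⟩ := Nat.exists_eq_add_of_le' hn
  refine IsLeast.csInf_eq ⟨⟨_, isFaultTolerant_cycleGraph m⟩, ?_⟩
  rintro _ ⟨B, hB, rfl⟩
  exact four_le_ncard_of_isFaultTolerant_cycleGraph hB
end

section
/- For the star graph K_{1,n} with n ≥ 3 leaves, the 1-fault tolerant zero forcing number satisfies Z_t(K_{1,n}) = n. -/
open SimpleGraph

/-- In a star, a pair of white leaves stays white after one step. -/
theorem not_mem_zfStep_star {n : ℕ} {B : Set (Unit ⊕ Fin n)} {i j : Fin n} (hij : i ≠ j)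
    (hi : Sum.inr i ∉ B) (hj : Sum.inr j ∉ B) :
    Sum.inr i ∉ zfStep (completeBipartiteGraph Unit (Fin n)) B := by
  rintro (h | ⟨b, -, hadj, huniq⟩)
  · exact hi h
  · rcases b with u | k
    · exact hij (Sum.inr_injective (huniq (Sum.inr j) (by simp) hj)).symm
    · simp at hadj

/-- In a star, a pair of white leaves stays white forever. -/
theorem not_mem_iterate_zfStep_star {n : ℕ} {B : Set (Unit ⊕ Fin n)} {i j : Fin n} (hij : i ≠ j)
    (hi : Sum.inr i ∉ B) (hj : Sum.inr j ∉ B) (t : ℕ) :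
    Sum.inr i ∉ (zfStep (completeBipartiteGraph Unit (Fin n)))^[t] B := by
  induction t generalizing B with
  | zero => exact hi
  | succ t ih =>
    rw [Function.iterate_succ_apply]
    exact ih (not_mem_zfStep_star hij hi hj) (not_mem_zfStep_star hij.symm hj hi)

/-- A zero forcing set of a star misses at most one leaf. -/
theorem IsZeroForcingSet.subsingleton_star {n : ℕ} {B : Set (Unit ⊕ Fin n)}
    (hB : IsZeroForcingSet (completeBipartiteGraph Unit (Fin n)) B) :
    {i : Fin n | Sum.inr i ∉ B}.Subsingleton := by
  obtain ⟨t, ht⟩ := hB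
  intro i hi j hj
  by_contra hij
  exact not_mem_iterate_zfStep_star hij hi hj t (ht ▸ Set.mem_univ _)

theorem IsZeroForcingSet.le_ncard_star {n : ℕ} {B : Set (Unit ⊕ Fin n)}
    (hB : IsZeroForcingSet (completeBipartiteGraph Unit (Fin n)) B) :
    n ≤ B.ncard + 1 := by
  have hwhite := Set.ncard_le_one_iff_subsingleton.2 hB.subsingleton_star
  have hblue : {i : Fin n | Sum.inr i ∉ B}ᶜ.ncard ≤ B.ncard := by
    rw [← Set.ncard_image_of_injective _ (Sum.inr_injective (α := Unit))]
    refine Set.ncard_le_ncard ?_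
    rintro _ ⟨i, hi, rfl⟩
    exact not_not.1 hi
  have hadd := Set.ncard_add_ncard_compl {i : Fin n | (Sum.inr i : Unit ⊕ Fin n) ∉ B}
  rw [Nat.card_fin] at hadd
  omega

/-- In a star, a set that contains a leaf and misses at most one leaf is zero forcing. -/
theorem isZeroForcingSet_star {n : ℕ} {B : Set (Unit ⊕ Fin n)} {i : Fin n}
    (hi : Sum.inr i ∈ B) (hB : {i : Fin n | Sum.inr i ∉ B}.Subsingleton) :
    IsZeroForcingSet (completeBipartiteGraph Unit (Fin n)) B := by
  have hcenter : Sum.inl () ∈ zfStep (completeBipartiteGraph Unit (Fin n)) B := by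
    refine Or.inr ⟨Sum.inr i, hi, by simp, ?_⟩
    rintro (⟨⟩ | k) hk -
    · rfl
    · simp at hk
  refine ⟨2, Set.eq_univ_of_forall ?_⟩
  rintro (⟨⟩ | j)
  · exact Or.inl hcenter
  · by_cases hj : Sum.inr j ∈ B
    · exact Or.inl (Or.inl hj)
    · refine Or.inr ⟨Sum.inl (), hcenter, by simp, ?_⟩
      rintro (⟨⟩ | k) hk hkB
      · simp at hk
      · exact congrArg Sum.inr (hB (fun h => hkB (Or.inl h)) hj)

/-- The leaves of a star form a 1-fault tolerant set. -/
theorem isFaultTolerant_star_leaves {n : ℕ} (hn : 2 ≤ n) :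
    IsFaultTolerant (completeBipartiteGraph Unit (Fin n)) 1 (Set.range Sum.inr) := by
  intro F hF hcard
  have hrange : (Set.range (Sum.inr : Fin n → Unit ⊕ Fin n)).ncard = n := by
    rw [← Set.image_univ, Set.ncard_image_of_injective _ Sum.inr_injective, Set.ncard_univ,
      Nat.card_fin]
  obtain ⟨x, hx⟩ : F.Nonempty := Set.nonempty_of_ncard_ne_zero (by omega)
  obtain ⟨i, rfl⟩ := hF hx
  refine isZeroForcingSet_star hx ?_
  have hdiff := Set.ncard_sdiff_add_ncard_of_subset hF
  have hone : (Set.range (Sum.inr : Fin n → Unit ⊕ Fin n) \ F).ncard ≤ 1 := by omega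
  intro j hj k hk
  exact Sum.inr_injective
    (Set.ncard_le_one_iff_subsingleton.1 hone ⟨⟨j, rfl⟩, hj⟩ ⟨⟨k, rfl⟩, hk⟩)

theorem IsFaultTolerant.le_ncard_star {n : ℕ} (hn : 2 ≤ n) {B : Set (Unit ⊕ Fin n)}
    (hB : IsFaultTolerant (completeBipartiteGraph Unit (Fin n)) 1 B) : n ≤ B.ncard := by
  obtain ⟨F, hF, hcard⟩ := Set.exists_subset_card_eq (Nat.sub_le B.ncard 1)
  have := (hB F hF hcard).le_ncard_star
  omega

theorem stmt6 (n : ℕ) (hn : 3 ≤ n) :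
    ftZeroForcingNumber (completeBipartiteGraph Unit (Fin n)) 1 = n := by
  have hmem : n ∈ {m | ∃ B : Set (Unit ⊕ Fin n),
      IsFaultTolerant (completeBipartiteGraph Unit (Fin n)) 1 B ∧ B.ncard = m} := by
    refine ⟨Set.range Sum.inr, isFaultTolerant_star_leaves (by omega), ?_⟩
    rw [← Set.image_univ, Set.ncard_image_of_injective _ Sum.inr_injective, Set.ncard_univ,
      Nat.card_fin]
  refine le_antisymm (Nat.sInf_le hmem) (le_csInf ⟨n, hmem⟩ ?_)
  rintro _ ⟨B, hB, rfl⟩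
  exact hB.le_ncard_star (by omega)
end

section
/- Let T be a tree (a finite connected acyclic simple graph) with at least two vertices. Then the set of all leaves of T (vertices of degree 1) is a 1-fault tolerant zero forcing set of T; consequently Z_t(T) ≤ ℓ(T), where ℓ(T) is the number of leaves of T. -/
open SimpleGraph

theorem subset_zfStep {V : Type*} (G : SimpleGraph V) (B : Set V) : B ⊆ zfStep G B :=
  Set.subset_union_left

/-- On a finite graph, a set is zero forcing as soon as its only superset closed under the color
change rule is the whole vertex set. -/
theorem IsZeroForcingSet.of_forall_closed {V : Type*} [Finite V] {G : SimpleGraph V} {B : Set V}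
    (h : ∀ C, B ⊆ C → zfStep G C = C → C = Set.univ) : IsZeroForcingSet G B := by
  have hmono : Monotone fun n ↦ (zfStep G)^[n] B := fun _ _ hmn ↦
    Function.monotone_iterate_of_id_le (subset_zfStep G) hmn B
  obtain ⟨n, hn⟩ := WellFoundedGT.monotone_chain_condition ⟨_, hmono⟩
  refine ⟨n, h _ (hmono n.zero_le) ?_⟩
  rw [← Function.iterate_succ_apply' (zfStep G)]
  exact (hn (n + 1) n.le_succ).symm

/-- In a tree, a vertex has at most one neighbor closer to the root. -/
theorem SimpleGraph.IsTree.eq_of_adj_of_dist_eq_add_one {V : Type*} {T : SimpleGraph V}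
    (hT : T.IsTree) {r c v w : V} (hv : T.Adj c v) (hw : T.Adj c w)
    (hdv : T.dist r c = T.dist r v + 1) (hdw : T.dist r c = T.dist r w + 1) : v = w := by
  obtain ⟨p, hp⟩ := hT.connected.exists_walk_length_eq_dist r v
  obtain ⟨q, hq⟩ := hT.connected.exists_walk_length_eq_dist r w
  have hp' : (p.concat hv.symm).IsPath :=
    Walk.isPath_of_length_eq_dist _ (by rw [Walk.length_concat, hp, hdv])
  have hq' : (q.concat hw.symm).IsPath :=
    Walk.isPath_of_length_eq_dist _ (by rw [Walk.length_concat, hq, hdw])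
  have := congrArg Walk.penultimate ((hT.existsUnique_path r c).unique hp' hq')
  simpa using this

/-- In a nontrivial finite tree, a vertex that is the root or not a leaf has a neighbor farther
from the root. -/
theorem SimpleGraph.IsTree.exists_adj_dist_eq_add_one {V : Type*} [Finite V] [Nontrivial V]
    {T : SimpleGraph V} (hT : T.IsTree) {r v : V}
    (h : v = r ∨ (T.neighborSet v).ncard ≠ 1) : ∃ c, T.Adj v c ∧ T.dist r c = T.dist r v + 1 := by
  obtain ⟨a, ha⟩ := hT.connected.preconnected.exists_adj_of_nontrivial v
  by_contra! hno
  have hparent : ∀ c, T.Adj v c → T.dist r v = T.dist r c + 1 := fun c hc ↦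
    (hT.dist_eq_dist_add_one_of_adj r hc).resolve_right (hno c hc)
  rcases h with rfl | h
  · simpa using hparent a ha
  · refine h (Set.ncard_eq_one.mpr ⟨a, Set.eq_singleton_iff_unique_mem.mpr ⟨ha, fun c hc ↦ ?_⟩⟩)
    exact hT.eq_of_adj_of_dist_eq_add_one hc ha (hparent c hc) (hparent a ha)

/-- A set containing all leaves of a nontrivial finite tree, except possibly one, is zero
forcing. -/
theorem SimpleGraph.IsTree.isZeroForcingSet_of_leaves_diff_singleton_subset {V : Type*} [Finite V]
    [Nontrivial V] {T : SimpleGraph V} (hT : T.IsTree) (r : V) {F : Set V}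
    (hF : {v : V | (T.neighborSet v).ncard = 1} \ {r} ⊆ F) : IsZeroForcingSet T F := by
  refine .of_forall_closed fun C hFC hC ↦ ?_
  by_contra hne
  obtain ⟨v, hvC, hmax⟩ := Set.exists_max_image Cᶜ (T.dist r) (Set.toFinite _)
    (Set.nonempty_compl.mpr hne)
  have hfar : ∀ w, T.dist r v < T.dist r w → w ∈ C := fun w hw ↦ by
    by_contra hwC
    exact (hmax w hwC).not_gt hw
  obtain ⟨c, hvc, hc⟩ : ∃ c, T.Adj v c ∧ T.dist r c = T.dist r v + 1 := by
    refine hT.exists_adj_dist_eq_add_one ?_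
    by_contra! hv
    exact hvC (hFC (hF ⟨hv.2, hv.1⟩))
  refine hvC (hC ▸ Or.inr ⟨c, hfar c (by omega), hvc.symm, fun w hcw hw ↦ ?_⟩)
  refine hT.eq_of_adj_of_dist_eq_add_one hcw hvc.symm ?_ hc
  refine (hT.dist_eq_dist_add_one_of_adj r hcw).resolve_right fun hd ↦ hw (hfar w (by omega))

theorem stmt8 {V : Type*} [Fintype V] (T : SimpleGraph V) (hT : T.IsTree)
    (hcard : 2 ≤ Fintype.card V) :
    IsFaultTolerant T 1 {v : V | (T.neighborSet v).ncard = 1} ∧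
      ftZeroForcingNumber T 1 ≤ {v : V | (T.neighborSet v).ncard = 1}.ncard := by
  have hV : Nontrivial V := Fintype.one_lt_card_iff_nontrivial.mp hcard
  have hfault : IsFaultTolerant T 1 {v : V | (T.neighborSet v).ncard = 1} := by
    intro F hFL hF
    have hdiff := Set.ncard_sdiff_add_ncard_of_subset hFL
    obtain ⟨r, hr⟩ := (Set.ncard_le_one_iff_subset_singleton (Set.toFinite _)).mp
      (show ({v : V | (T.neighborSet v).ncard = 1} \ F).ncard ≤ 1 by omega)
    refine hT.isZeroForcingSet_of_leaves_diff_singleton_subset r fun v hv ↦ ?_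
    by_contra hvF
    exact hv.2 (hr ⟨hv.1, hvF⟩)
  exact ⟨hfault, Nat.sInf_le ⟨_, hfault, rfl⟩⟩
end

section
/- Let G be a finite simple graph with twin vertices u and v (either independent twins with N(u) = N(v), or adjacent twins with N[u] = N[v]). Then every 1-fault tolerant zero forcing set of G contains both u and v. -/
open SimpleGraph

/-- `u` and `v` are twins: either independent twins (non-adjacent with the same open
neighborhood) or adjacent twins (adjacent with the same closed neighborhood). -/
def IsTwinPair {V : Type*} (G : SimpleGraph V) (u v : V) : Prop :=
  u ≠ v ∧ ((¬ G.Adj u v ∧ G.neighborSet u = G.neighborSet v) ∨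
    (G.Adj u v ∧ insert u (G.neighborSet u) = insert v (G.neighborSet v)))

lemma IsTwinPair.symm {V : Type*} {G : SimpleGraph V} {u v : V} (h : IsTwinPair G u v) :
    IsTwinPair G v u := by
  obtain ⟨hne, h | h⟩ := h
  · exact ⟨hne.symm, Or.inl ⟨fun h' => h.1 h'.symm, h.2.symm⟩⟩
  · exact ⟨hne.symm, Or.inr ⟨h.1.symm, h.2.symm⟩⟩

/-- A vertex other than the two twins is adjacent to both or to neither. -/
lemma IsTwinPair.adj_of_adj {V : Type*} {G : SimpleGraph V} {u v b : V}
    (h : IsTwinPair G u v) (hbv : b ≠ v) (hb : G.Adj b u) : G.Adj b v := by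
  obtain ⟨-, ⟨-, h⟩ | ⟨-, h⟩⟩ := h
  · have hmem : b ∈ G.neighborSet u := hb.symm
    rw [h] at hmem
    exact G.adj_symm hmem
  · have hmem : b ∈ insert u (G.neighborSet u) := Or.inr hb.symm
    rw [h] at hmem
    exact G.adj_symm (hmem.resolve_left hbv)

/-- The color change rule cannot turn a white twin blue while the other one is white. -/
lemma IsTwinPair.notMem_zfStep {V : Type*} {G : SimpleGraph V} {u v : V}
    (h : IsTwinPair G u v) {F : Set V} (hu : u ∉ F) (hv : v ∉ F) : u ∉ zfStep G F := by
  rintro (hF | ⟨b, hb, hadj, huniq⟩)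
  · exact hu hF
  · have hbv : b ≠ v := fun e => hv (e ▸ hb)
    exact h.1 (huniq v (h.adj_of_adj hbv hadj) hv).symm

/-- Every zero forcing set contains at least one vertex of each twin pair. -/
lemma IsZeroForcingSet.mem_or_mem_of_isTwinPair {V : Type*} {G : SimpleGraph V} {u v : V}
    {F : Set V} (hF : IsZeroForcingSet G F) (h : IsTwinPair G u v) : u ∈ F ∨ v ∈ F := by
  by_contra! hF'
  obtain ⟨n, hn⟩ := hF
  have key : ∀ n : ℕ, u ∉ (zfStep G)^[n] F ∧ v ∉ (zfStep G)^[n] F := by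
    intro n
    induction n with
    | zero => exact hF'
    | succ n ih =>
      rw [Function.iterate_succ_apply']
      exact ⟨h.notMem_zfStep ih.1 ih.2, h.symm.notMem_zfStep ih.2 ih.1⟩
  exact (key n).1 (hn ▸ Set.mem_univ u)

/-- A 1-fault tolerant set contains the first vertex of each twin pair. -/
lemma IsFaultTolerant.left_mem_of_isTwinPair {V : Type*} [Finite V] {G : SimpleGraph V}
    {u v : V} {B : Set V} (hB : IsFaultTolerant G 1 B) (h : IsTwinPair G u v) : u ∈ B := by
  by_contra hu
  obtain ⟨F, hFB, hFcard⟩ := Set.exists_subset_card_eq (Set.pred_ncard_le_ncard_sdiff_singleton B v)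
  rcases (hB F (hFB.trans Set.sdiff_subset) hFcard).mem_or_mem_of_isTwinPair h with hF | hF
  · exact hu (hFB hF).1
  · exact (hFB hF).2 rfl

theorem stmt13 {V : Type*} [Fintype V] (G : SimpleGraph V) (u v : V)
    (htwin : IsTwinPair G u v) (B : Set V) (hB : IsFaultTolerant G 1 B) :
    u ∈ B ∧ v ∈ B := by
  exact ⟨hB.left_mem_of_isTwinPair htwin, hB.left_mem_of_isTwinPair htwin.symm⟩
end

section
/- Let G be a finite simple graph with twin vertices u and v (either independent or adjacent twins) such that Z_t(G) exists and the deletion of v leaves no isolated vertices in G − v. Then Z_t(G − v) exists and 0 ≤ Z_t(G) − Z_t(G − v) ≤ 2. -/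
open SimpleGraph

/-- A fort: a nonempty set `F` such that no vertex outside `F` has exactly one neighbor in `F`. -/
def IsFort {V : Type*} (G : SimpleGraph V) (F : Set V) : Prop :=
  F.Nonempty ∧ ∀ b ∉ F, ∀ w ∈ F, G.Adj b w → ∃ w' ∈ F, w' ≠ w ∧ G.Adj b w'

/-- A set avoiding `v` which is a fort of `G - v`. -/
def IsFortOff {V : Type*} (G : SimpleGraph V) (v : V) (F : Set V) : Prop :=
  F.Nonempty ∧ v ∉ F ∧
    ∀ b ∉ F, b ≠ v → ∀ w ∈ F, G.Adj b w → ∃ w' ∈ F, w' ≠ w ∧ G.Adj b w'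

section ZeroForcing

variable {V : Type*} {G : SimpleGraph V}

theorem IsFort.disjoint_zfStep {F B : Set V} (hF : IsFort G F) (h : Disjoint B F) :
    Disjoint (zfStep G B) F := by
  rw [Set.disjoint_left] at h ⊢
  rintro w (hw | ⟨b, hb, hbw, hu⟩) hwF
  · exact h hw hwF
  · obtain ⟨w', hw', hne, hadj⟩ := hF.2 b (h hb) w hwF hbw
    exact hne (hu w' hadj fun hB => h hB hw')

theorem isZeroForcingSet_iff_fort [Finite V] {B : Set V} :
    IsZeroForcingSet G B ↔ ∀ F, IsFort G F → (B ∩ F).Nonempty := by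
  constructor
  · rintro ⟨n, hn⟩ F hF
    by_contra hBF
    rw [Set.not_nonempty_iff_eq_empty, ← Set.disjoint_iff_inter_eq_empty] at hBF
    have key : ∀ k, Disjoint ((zfStep G)^[k] B) F := by
      intro k
      induction k with
      | zero => exact hBF
      | succ k ih =>
        rw [Function.iterate_succ_apply']
        exact hF.disjoint_zfStep ih
    have := key n
    rw [hn] at this
    obtain ⟨x, hx⟩ := hF.1
    exact Set.disjoint_left.1 this (Set.mem_univ x) hx
  · intro h
    have hmono : Monotone fun n => (zfStep G)^[n] B := by
      refine monotone_nat_of_le_succ fun n => ?_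
      rw [Function.iterate_succ_apply']
      exact Set.subset_union_left
    obtain ⟨n, hn⟩ := WellFoundedGT.monotone_chain_condition ⟨_, hmono⟩
    have hfix : zfStep G ((zfStep G)^[n] B) = (zfStep G)^[n] B := by
      rw [← Function.iterate_succ_apply' (zfStep G)]
      exact (hn (n + 1) n.le_succ).symm
    have hBsub : B ⊆ (zfStep G)^[n] B := hmono n.zero_le
    refine ⟨n, ?_⟩
    generalize (zfStep G)^[n] B = C at hfix hBsub
    by_contra hC
    have hfort : IsFort G Cᶜ := by
      refine ⟨Set.nonempty_compl.2 hC, fun b hb w hw hbw => ?_⟩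
      by_contra! hcon
      refine hw (hfix ▸ Or.inr ⟨b, not_not.1 hb, hbw, fun w' hadj hw' => ?_⟩)
      by_contra hne
      exact hcon w' hw' hne hadj
    obtain ⟨x, hx, hx'⟩ := h _ hfort
    exact hx' (hBsub hx)

theorem isFaultTolerant_one_iff_fort [Finite V] [Nonempty V] {B : Set V} :
    IsFaultTolerant G 1 B ↔ ∀ F, IsFort G F → (B ∩ F).Nontrivial := by
  have huniv : IsFort G Set.univ := ⟨Set.univ_nonempty, fun b hb => absurd (Set.mem_univ b) hb⟩
  constructor
  · intro h F hF
    have hdel : ∀ b ∈ B, ∃ c ∈ B, c ∈ F ∧ c ≠ b := by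
      intro b hb
      obtain ⟨c, ⟨hc, hcb⟩, hcF⟩ := isZeroForcingSet_iff_fort.1
        (h (B \ {b}) Set.sdiff_subset (Set.ncard_sdiff_singleton_of_mem hb)) F hF
      exact ⟨c, hc, hcF, hcb⟩
    rcases B.eq_empty_or_nonempty with rfl | ⟨b, hb⟩
    · obtain ⟨x, hx, -⟩ := isZeroForcingSet_iff_fort.1 (h ∅ subset_rfl (by simp)) _ huniv
      exact hx.elim
    · obtain ⟨c, hc, hcF, -⟩ := hdel b hb
      obtain ⟨d, hd, hdF, hdc⟩ := hdel c hc
      exact ⟨c, ⟨hc, hcF⟩, d, ⟨hd, hdF⟩, hdc.symm⟩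
  · intro h S hS hcard
    rw [isZeroForcingSet_iff_fort]
    intro F hF
    obtain ⟨a, ⟨ha, haF⟩, b, ⟨hb, hbF⟩, hab⟩ := h F hF
    by_contra hSF
    have haS : a ∉ S := fun haS => hSF ⟨a, haS, haF⟩
    have hbS : b ∉ S := fun hbS => hSF ⟨b, hbS, hbF⟩
    have hsub : insert a (insert b S) ⊆ B :=
      Set.insert_subset ha (Set.insert_subset hb hS)
    have hle := Set.ncard_le_ncard hsub B.toFinite
    rw [Set.ncard_insert_of_notMem (by simp [hab, haS]) (Set.toFinite _),
      Set.ncard_insert_of_notMem hbS (Set.toFinite _)] at hle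
    omega

theorem ftZeroForcingNumber_le_add {W : Type*} {H : SimpleGraph W} {k c : ℕ}
    (hex : ∃ B, IsFaultTolerant G k B)
    (h : ∀ B, IsFaultTolerant G k B → ∃ B', IsFaultTolerant H k B' ∧ B'.ncard ≤ B.ncard + c) :
    ftZeroForcingNumber H k ≤ ftZeroForcingNumber G k + c := by
  obtain ⟨B, hB⟩ := hex
  obtain ⟨C, hC, hCcard⟩ := Nat.sInf_mem
    (s := {m | ∃ B : Set V, IsFaultTolerant G k B ∧ B.ncard = m}) ⟨_, B, hB, rfl⟩
  obtain ⟨C', hC', hle⟩ := h C hC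
  rw [hCcard] at hle
  have hmin : ftZeroForcingNumber H k ≤ C'.ncard := Nat.sInf_le ⟨C', hC', rfl⟩
  exact hmin.trans hle

theorem isFort_induce_ne_iff {v : V} {F : Set ↥{x : V | x ≠ v}} :
    IsFort (G.induce {x : V | x ≠ v}) F ↔ IsFortOff G v (Subtype.val '' F) := by
  simp only [IsFort, IsFortOff, Set.image_nonempty]
  refine and_congr_right fun _ => ⟨fun h => ⟨?_, ?_⟩, ?_⟩
  · rintro ⟨x, -, hx⟩
    exact x.2 hx
  · rintro b hb hbv _ ⟨w, hw, rfl⟩ hadj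
    obtain ⟨w', hw', hne, hadj'⟩ := h ⟨b, hbv⟩ (fun hbF => hb ⟨_, hbF, rfl⟩) w hw hadj
    exact ⟨w', ⟨w', hw', rfl⟩, fun h => hne (Subtype.ext h), hadj'⟩
  · rintro ⟨-, h⟩ b hb w hw hadj
    obtain ⟨_, ⟨w', hw', rfl⟩, hne, hadj'⟩ := h b.1
      (by rintro ⟨x, hx, hxb⟩; exact hb (Subtype.ext hxb ▸ hx)) b.2 w ⟨w, hw, rfl⟩ hadj
    exact ⟨w', hw', fun h => hne (h ▸ rfl), hadj'⟩

theorem isFaultTolerant_one_induce_ne_iff [Finite V] {v : V} [Nonempty ↥{x : V | x ≠ v}]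
    {B : Set ↥{x : V | x ≠ v}} :
    IsFaultTolerant (G.induce {x : V | x ≠ v}) 1 B ↔
      ∀ F, IsFortOff G v F → (Subtype.val '' B ∩ F).Nontrivial := by
  rw [isFaultTolerant_one_iff_fort]
  constructor
  · intro h F hF
    have himg : Subtype.val '' (Subtype.val ⁻¹' F : Set ↥{x : V | x ≠ v}) = F := by
      rw [Subtype.image_preimage_coe, Set.inter_eq_right]
      exact fun x hx hxv => hF.2.1 (hxv ▸ hx)
    have := h (Subtype.val ⁻¹' F) (isFort_induce_ne_iff.2 (himg.symm ▸ hF))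
    rw [← himg, ← Set.image_inter Subtype.val_injective]
    exact this.image Subtype.val_injective
  · intro h F hF
    have := h _ (isFort_induce_ne_iff.1 hF)
    rw [← Set.image_inter Subtype.val_injective] at this
    exact Set.nontrivial_of_image _ _ this

namespace IsTwinPair

variable {u v : V}

theorem adj_iff (h : IsTwinPair G u v) {w : V} (hu : w ≠ u) (hv : w ≠ v) :
    G.Adj w u ↔ G.Adj w v := by
  rw [G.adj_comm w u, G.adj_comm w v]
  rcases h.2 with ⟨-, h⟩ | ⟨-, h⟩
  · exact Set.ext_iff.1 h w
  · simpa [hu, hv] using Set.ext_iff.1 h w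

theorem isFort_pair (h : IsTwinPair G u v) : IsFort G {u, v} := by
  refine ⟨⟨u, by simp⟩, fun b hb w hw hadj => ?_⟩
  simp only [Set.mem_insert_iff, Set.mem_singleton_iff, not_or] at hb
  have hbuv := h.adj_iff hb.1 hb.2
  rcases hw with rfl | rfl
  · exact ⟨v, by simp, h.1.symm, hbuv.1 hadj⟩
  · exact ⟨u, by simp, h.1, hbuv.2 hadj⟩

theorem isFort_of_isFortOff (h : IsTwinPair G u v) {F : Set V} (hF : IsFortOff G v F)
    (hu : u ∉ F) : IsFort G F := by
  refine ⟨hF.1, fun b hb w hw hadj => ?_⟩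
  by_cases hbv : b = v
  · subst hbv
    have htw : ∀ x ∈ F, (G.Adj u x ↔ G.Adj b x) := fun x hx => by
      rw [G.adj_comm u, G.adj_comm b]
      exact h.adj_iff (ne_of_mem_of_not_mem hx hu) (ne_of_mem_of_not_mem hx hb)
    obtain ⟨w', hw', hne, hadj'⟩ := hF.2.2 u hu h.1 w hw ((htw w hw).2 hadj)
    exact ⟨w', hw', hne, (htw w' hw').1 hadj'⟩
  · exact hF.2.2 b hb hbv w hw hadj

theorem isFort_insert (h : IsTwinPair G u v) {F : Set V} (hF : IsFortOff G v F)
    (hu : u ∈ F) : IsFort G (insert v F) := by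
  refine ⟨Set.insert_nonempty _ _, fun b hb w hw hadj => ?_⟩
  rw [Set.mem_insert_iff, not_or] at hb
  have hbuv := h.adj_iff (ne_of_mem_of_not_mem hu hb.2).symm hb.1
  rcases hw with rfl | hw
  · exact ⟨u, Or.inr hu, h.1, hbuv.2 hadj⟩
  · obtain ⟨w', hw', hne, hadj'⟩ := hF.2.2 b hb.2 hb.1 w hw hadj
    exact ⟨w', Or.inr hw', hne, hadj'⟩

theorem isFortOff_swap (h : IsTwinPair G u v) {F : Set V} (hF : IsFort G F)
    (hu : u ∉ F) (hv : v ∈ F) : IsFortOff G v (insert u (F \ {v})) := by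
  refine ⟨Set.insert_nonempty _ _, by simp [h.1.symm], fun b hb hbv w hw hadj => ?_⟩
  have hbu : b ≠ u := fun hbu => hb (Or.inl hbu)
  have hbF : b ∉ F := fun hbF => hb (Or.inr ⟨hbF, hbv⟩)
  have hbuv := h.adj_iff hbu hbv
  rcases hw with rfl | ⟨hw, hwv⟩
  · obtain ⟨w', hw', hne, hadj'⟩ := hF.2 b hbF v hv (hbuv.1 hadj)
    exact ⟨w', Or.inr ⟨hw', hne⟩, ne_of_mem_of_not_mem hw' hu, hadj'⟩
  · obtain ⟨w', hw', hne, hadj'⟩ := hF.2 b hbF w hw hadj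
    by_cases hw'v : w' = v
    · subst hw'v
      exact ⟨u, Or.inl rfl, (ne_of_mem_of_not_mem hw hu).symm, hbuv.2 hadj'⟩
    · exact ⟨w', Or.inr ⟨hw', hw'v⟩, hne, hadj'⟩

theorem _root_.IsFort.isFortOff {F : Set V} (hF : IsFort G F) (hv : v ∉ F) : IsFortOff G v F :=
  ⟨hF.1, hv, fun b hb _ => hF.2 b hb⟩

theorem fort_hitting_of_fortOff_hitting (h : IsTwinPair G u v) {B : Set V}
    (hB : ∀ F, IsFortOff G v F → (B ∩ F).Nontrivial) {F : Set V} (hF : IsFort G F) :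
    (insert u (insert v B) ∩ F).Nontrivial := by
  by_cases hv : v ∈ F
  · by_cases hu : u ∈ F
    · exact ⟨u, ⟨by simp, hu⟩, v, ⟨by simp, hv⟩, h.1⟩
    · obtain ⟨x, ⟨hxB, hx⟩, hxu⟩ := (hB _ (h.isFortOff_swap hF hu hv)).exists_ne u
      obtain ⟨hxF, hxv⟩ := hx.resolve_left hxu
      exact ⟨x, ⟨by simp [hxB], hxF⟩, v, ⟨by simp, hv⟩, hxv⟩
  · refine (hB F (hF.isFortOff hv)).mono (Set.inter_subset_inter_left _ ?_)
    exact (Set.subset_insert _ _).trans (Set.subset_insert _ _)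

theorem exists_common_vertex (h : IsTwinPair G u v)
    (hiso : ∃ x, x ≠ v ∧ G.Adj u x) {B : Set V}
    (hB : ∀ F, IsFort G F → (B ∩ F).Nontrivial) :
    ∃ z, z ≠ v ∧ z ≠ u ∧
      ∀ F, IsFortOff G v F → u ∈ F → (∀ x ∈ B, x ∈ F → x = u) → z ∈ F := by
  set P : Set V → Prop := fun F => IsFortOff G v F ∧ ∀ x ∈ B, x ∈ F → x = u with hP
  -- every fort meeting `B` at most in `u` contains `u`
  have huP : ∀ F, P F → u ∈ F := by
    rintro F ⟨hF, hFB⟩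
    by_contra hu
    obtain ⟨x, hx, hxu⟩ := (hB F (h.isFort_of_isFortOff hF hu)).exists_ne u
    exact hxu (hFB x hx.1 hx.2)
  have hnotfort : ∀ F, P F → ¬ IsFort G F := by
    rintro F ⟨-, hFB⟩ hF
    obtain ⟨x, hx, hxu⟩ := (hB F hF).exists_ne u
    exact hxu (hFB x hx.1 hx.2)
  by_cases hne : ∃ F, P F
  swap
  · obtain ⟨x, hxv, hux⟩ := hiso
    exact ⟨x, hxv, hux.ne', fun F hF _ hFB => absurd ⟨F, hF, hFB⟩ hne⟩
  set W : Set V := ⋃₀ {F | P F} with hW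
  have hsub : ∀ F, P F → F ⊆ W := fun F hF => Set.subset_sUnion_of_mem hF
  have hWP : P W := by
    refine ⟨⟨?_, ?_, ?_⟩, ?_⟩
    · obtain ⟨F, hF⟩ := hne
      exact ⟨u, hsub F hF (huP F hF)⟩
    · rintro ⟨F, hF, hv⟩
      exact hF.1.2.1 hv
    · rintro b hb hbv w ⟨F, hF, hw⟩ hadj
      obtain ⟨w', hw', h'⟩ := hF.1.2.2 b (fun hbF => hb (hsub F hF hbF)) hbv w hw hadj
      exact ⟨w', hsub F hF hw', h'⟩
    · rintro x hx ⟨F, hF, hxF⟩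
      exact hF.2 x hx hxF
  have huW := huP W hWP
  have hvW : v ∉ W := hWP.1.2.1
  have hWu : (W \ {u}).Nonempty := by
    obtain ⟨x, hxv, hux⟩ := hiso
    by_cases hx : x ∈ W
    · exact ⟨x, hx, hux.ne'⟩
    · obtain ⟨w', hw', hne, -⟩ := hWP.1.2.2 x hx hxv u huW hux.symm
      exact ⟨w', hw', hne⟩
  have hWnot : ¬ IsFortOff G v (W \ {u}) := by
    intro hF
    have := huP (W \ {u}) ⟨hF, fun x hx hxW => hWP.2 x hx hxW.1⟩
    exact this.2 rfl
  simp only [IsFortOff, hWu, true_and, not_and] at hWnot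
  have hex := hWnot fun hv => hvW hv.1
  push Not at hex
  obtain ⟨w, hwW, hwv, z, ⟨hzW, hzu⟩, hwz, huniq⟩ := hex
  refine ⟨z, ne_of_mem_of_not_mem hzW hvW, hzu, fun F hF huF hFB => ?_⟩
  have hFW : F ⊆ W := hsub F ⟨hF, hFB⟩
  have hwuniq : ∀ x ∈ W, x ≠ u → G.Adj w x → x = z := by
    intro x hx hxu hwx
    by_contra hxz
    exact huniq x ⟨hx, hxu⟩ hxz hwx
  by_cases hwu : w = u
  · subst hwu
    have hadj : ∀ x ∈ W, x ≠ w → (G.Adj v x ↔ G.Adj w x) := fun x hx hxw => by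
      rw [G.adj_comm v, G.adj_comm w]
      exact (h.adj_iff hxw (ne_of_mem_of_not_mem hx hvW)).symm
    by_contra hzF
    by_cases hvw : G.Adj v w
    · refine hnotfort W hWP ⟨hWP.1.1, fun b hb x hx hbx => ?_⟩
      by_cases hbv : b = v
      · subst hbv
        by_cases hxw : x = w
        · exact ⟨z, hzW, hxw ▸ hzu, (hadj z hzW hzu).2 hwz⟩
        · exact ⟨w, huW, Ne.symm hxw, hvw⟩
      · exact hWP.1.2.2 b hb hbv x hx hbx
    · refine hnotfort F ⟨hF, hFB⟩ ⟨hF.1, fun b hb x hx hbx => ?_⟩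
      by_cases hbv : b = v
      · subst hbv
        have hxw : x ≠ w := fun hxw => hvw (hxw ▸ hbx)
        exact absurd (hwuniq x (hFW hx) hxw ((hadj x (hFW hx) hxw).1 hbx) ▸ hx) hzF
      · exact hF.2.2 b hb hbv x hx hbx
  · have hwW' : w ∉ W := fun hw => hwW ⟨hw, hwu⟩
    have hwadj : G.Adj w u := by
      obtain ⟨x, hx, hxz, hwx⟩ := hWP.1.2.2 w hwW' hwv z hzW hwz
      by_cases hxu : x = u
      · exact hxu ▸ hwx
      · exact absurd (hwuniq x hx hxu hwx) hxz
    obtain ⟨x, hx, hxu, hwx⟩ := hF.2.2 w (fun hw => hwW' (hFW hw)) hwv u huF hwadj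
    exact hwuniq x (hFW hx) hxu hwx ▸ hx

theorem exists_fortOff_hitting [Finite V] (h : IsTwinPair G u v)
    (hiso : ∃ x, x ≠ v ∧ G.Adj u x) {B : Set V}
    (hB : ∀ F, IsFort G F → (B ∩ F).Nontrivial) :
    ∃ C : Set V, v ∉ C ∧ C.ncard ≤ B.ncard ∧ ∀ F, IsFortOff G v F → (C ∩ F).Nontrivial := by
  obtain ⟨z, hzv, hzu, hz⟩ := h.exists_common_vertex hiso hB
  have huvB : u ∈ B ∧ v ∈ B := by
    have hpair := hB _ h.isFort_pair
    obtain ⟨x, ⟨hxB, hx⟩, hxv⟩ := hpair.exists_ne v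
    obtain ⟨y, ⟨hyB, hy⟩, hyu⟩ := hpair.exists_ne u
    exact ⟨hx.resolve_right hxv ▸ hxB, hy.resolve_left hyu ▸ hyB⟩
  refine ⟨insert z (B \ {v}), by simp [hzv.symm], ?_, fun F hF => ?_⟩
  · exact (Set.ncard_insert_le _ _).trans
      (Set.ncard_sdiff_singleton_add_one huvB.2 B.toFinite).le
  by_cases hu : u ∈ F
  · have huC : u ∈ insert z (B \ {v}) ∩ F := ⟨Or.inr ⟨huvB.1, h.1⟩, hu⟩
    by_cases hFB : ∀ x ∈ B, x ∈ F → x = u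
    · exact ⟨u, huC, z, ⟨Or.inl rfl, hz F hF hu hFB⟩, hzu.symm⟩
    · push Not at hFB
      obtain ⟨x, hxB, hxF, hxu⟩ := hFB
      exact ⟨u, huC, x, ⟨Or.inr ⟨hxB, ne_of_mem_of_not_mem hxF hF.2.1⟩, hxF⟩, hxu.symm⟩
  · refine (hB F (h.isFort_of_isFortOff hF hu)).mono fun x hx => ⟨Or.inr ⟨hx.1, ?_⟩, hx.2⟩
    exact ne_of_mem_of_not_mem hx.2 hF.2.1

end IsTwinPair

end ZeroForcing

theorem stmt14 {V : Type*} [Fintype V] [DecidableEq V] (G : SimpleGraph V) (u v : V)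
    (htwin : IsTwinPair G u v)
    (hex : ∃ B : Set V, IsFaultTolerant G 1 B)
    (hiso : ∀ w, ∃ x, (G.induce {x : V | x ≠ v}).Adj w x) :
    (∃ B : Set ↥{x : V | x ≠ v}, IsFaultTolerant (G.induce {x : V | x ≠ v}) 1 B) ∧
      0 ≤ (ftZeroForcingNumber G 1 : ℤ) -
        ftZeroForcingNumber (G.induce {x : V | x ≠ v}) 1 ∧
      (ftZeroForcingNumber G 1 : ℤ) -
        ftZeroForcingNumber (G.induce {x : V | x ≠ v}) 1 ≤ 2 := by
  have : Nonempty V := ⟨u⟩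
  have : Nonempty ↥{x : V | x ≠ v} := ⟨⟨u, htwin.1⟩⟩
  have hnbr : ∃ x, x ≠ v ∧ G.Adj u x := by
    obtain ⟨x, hx⟩ := hiso ⟨u, htwin.1⟩
    exact ⟨x.1, x.2, hx⟩
  have hdown : ∀ B : Set V, IsFaultTolerant G 1 B →
      ∃ C, IsFaultTolerant (G.induce {x : V | x ≠ v}) 1 C ∧ C.ncard ≤ B.ncard + 0 := by
    intro B hB
    obtain ⟨C, hvC, hcard, hC⟩ :=
      htwin.exists_fortOff_hitting hnbr (isFaultTolerant_one_iff_fort.1 hB)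
    have himg : Subtype.val '' (Subtype.val ⁻¹' C : Set ↥{x : V | x ≠ v}) = C := by
      rw [Subtype.image_preimage_coe, Set.inter_eq_right]
      exact fun x hx hxv => hvC (hxv ▸ hx)
    refine ⟨Subtype.val ⁻¹' C, isFaultTolerant_one_induce_ne_iff.2 (himg.symm ▸ hC), ?_⟩
    rwa [← Set.ncard_image_of_injective _ Subtype.val_injective, himg]
  have hup : ∀ C, IsFaultTolerant (G.induce {x : V | x ≠ v}) 1 C →
      ∃ B : Set V, IsFaultTolerant G 1 B ∧ B.ncard ≤ C.ncard + 2 := by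
    intro C hC
    refine ⟨insert u (insert v (Subtype.val '' C)), isFaultTolerant_one_iff_fort.2 fun F hF =>
      htwin.fort_hitting_of_fortOff_hitting (isFaultTolerant_one_induce_ne_iff.1 hC) hF, ?_⟩
    rw [← Set.ncard_image_of_injective C Subtype.val_injective]
    exact (Set.ncard_insert_le _ _).trans (Nat.succ_le_succ (Set.ncard_insert_le _ _))
  have hex' : ∃ C, IsFaultTolerant (G.induce {x : V | x ≠ v}) 1 C := by
    obtain ⟨B, hB⟩ := hex
    obtain ⟨C, hC, -⟩ := hdown B hB
    exact ⟨C, hC⟩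
  have hle := ftZeroForcingNumber_le_add hex hdown
  have hge := ftZeroForcingNumber_le_add hex' hup
  exact ⟨hex', by omega, by omega⟩
end

section
/- For the path graph P_n on n ≥ 2 vertices, the fault propagation time satisfies fpt(P_n) = n − 1. -/
open SimpleGraph

/-- The propagation time of the set `B`: least number of simultaneous
applications of the color change rule needed to color every vertex blue. -/
noncomputable def propTime {V : Type*} (G : SimpleGraph V) (B : Set V) : ℕ :=
  sInf {k : ℕ | (zfStep G)^[k] B = Set.univ}

/-- The fault propagation time of `B`: the maximum of `pt(G, B \ {b})` over `b ∈ B`. -/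
noncomputable def faultPropTime {V : Type*} (G : SimpleGraph V) (B : Set V) : ℕ :=
  sSup {t : ℕ | ∃ b ∈ B, t = propTime G (B \ {b})}

/-- The fault propagation time of `G`: the minimum of `fpt(G, B)` over all
minimum `1`-fault tolerant zero forcing sets `B`. -/
noncomputable def faultPropTimeGraph {V : Type*} (G : SimpleGraph V) : ℕ :=
  sInf {t : ℕ | ∃ B : Set V, IsFaultTolerant G 1 B ∧ B.ncard = ftZeroForcingNumber G 1 ∧
    t = faultPropTime G B}

theorem zfStep_empty {V : Type*} (G : SimpleGraph V) : zfStep G ∅ = ∅ := by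
  simp [zfStep]

theorem iterate_zfStep_pathGraph_first {n : ℕ} (a : Fin n) (ha : a.val = 0) (k : ℕ) :
    (zfStep (pathGraph n))^[k] {a} = {v | v.val ≤ k} := by
  induction k with
  | zero =>
    ext v
    simp [Fin.ext_iff, ha]
  | succ k ih =>
    rw [Function.iterate_succ_apply', ih]
    ext v
    simp only [zfStep, Set.mem_union, Set.mem_ofPred_eq, pathGraph_adj]
    constructor
    · rintro (h | ⟨b, hb, h, -⟩) <;> omega
    · intro h
      rcases Nat.lt_or_ge k v.val with hv | hv
      · refine Or.inr ⟨⟨k, by omega⟩, le_rfl, Or.inl (by simp only; omega), ?_⟩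
        intro w hw hwk
        simp only at hw
        ext
        omega
      · exact Or.inl hv

theorem iterate_zfStep_pathGraph_last {n : ℕ} (a : Fin n) (ha : a.val + 1 = n) (k : ℕ) :
    (zfStep (pathGraph n))^[k] {a} = {v | n ≤ v.val + 1 + k} := by
  induction k with
  | zero =>
    ext v
    simp only [Function.iterate_zero, id, Set.mem_singleton_iff, Fin.ext_iff, Set.mem_ofPred_eq]
    omega
  | succ k ih =>
    rw [Function.iterate_succ_apply', ih]
    ext v
    simp only [zfStep, Set.mem_union, Set.mem_ofPred_eq, pathGraph_adj]
    constructor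
    · rintro (h | ⟨b, hb, h, -⟩) <;> omega
    · intro h
      rcases Nat.lt_or_ge (v.val + 1 + k) n with hv | hv
      · refine Or.inr ⟨⟨v.val + 1, by omega⟩, by simp only; omega, Or.inr rfl, ?_⟩
        intro w hw hwk
        simp only at hw
        ext
        omega
      · exact Or.inl hv

theorem iterate_zfStep_pathGraph_endpoint_eq_univ_iff {n : ℕ} (a : Fin n)
    (ha : a.val = 0 ∨ a.val + 1 = n) (k : ℕ) :
    (zfStep (pathGraph n))^[k] {a} = Set.univ ↔ n - 1 ≤ k := by
  have hn : 0 < n := a.pos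
  rcases ha with ha | ha
  · rw [iterate_zfStep_pathGraph_first a ha, Set.eq_univ_iff_forall]
    refine ⟨fun h => h ⟨n - 1, by omega⟩, fun h v => ?_⟩
    simp only [Set.mem_ofPred_eq]
    omega
  · rw [iterate_zfStep_pathGraph_last a ha, Set.eq_univ_iff_forall]
    refine ⟨fun h => ?_, fun h v => ?_⟩
    · have := h ⟨0, hn⟩
      simp only [Set.mem_ofPred_eq] at this
      omega
    · simp only [Set.mem_ofPred_eq]
      omega

theorem isZeroForcingSet_pathGraph_singleton_iff {n : ℕ} (a : Fin n) :
    IsZeroForcingSet (pathGraph n) {a} ↔ a.val = 0 ∨ a.val + 1 = n := by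
  refine ⟨?_, fun ha =>
    ⟨n - 1, (iterate_zfStep_pathGraph_endpoint_eq_univ_iff a ha _).2 le_rfl⟩⟩
  rintro ⟨k, hk⟩
  by_contra! h
  have hfix : zfStep (pathGraph n) {a} = {a} := by
    refine Set.union_eq_left.2 ?_
    rintro w ⟨b, rfl, -, hw⟩
    have h₁ := hw ⟨b.val + 1, by omega⟩ (pathGraph_adj.2 (Or.inl rfl)) (by simp [Fin.ext_iff])
    have h₂ := hw ⟨b.val - 1, by omega⟩ (pathGraph_adj.2 (Or.inr (by simp only; omega)))
      (by simp only [Set.mem_singleton_iff, Fin.ext_iff]; omega)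
    simp only [Fin.ext_iff] at h₁ h₂
    omega
  rw [Function.iterate_fixed hfix, Set.eq_univ_iff_forall] at hk
  exact h.1 (congrArg Fin.val (hk ⟨0, a.pos⟩)).symm

theorem propTime_pathGraph_singleton {n : ℕ} {a : Fin n}
    (h : IsZeroForcingSet (pathGraph n) {a}) : propTime (pathGraph n) {a} = n - 1 := by
  rw [isZeroForcingSet_pathGraph_singleton_iff] at h
  simp only [propTime, iterate_zfStep_pathGraph_endpoint_eq_univ_iff a h]
  exact csInf_Ici

theorem two_le_ncard_of_isFaultTolerant_one {V : Type*} [Nonempty V] {G : SimpleGraph V}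
    {B : Set V} (h : IsFaultTolerant G 1 B) : 2 ≤ B.ncard := by
  by_contra! hB
  refine not_isZeroForcingSet_empty G (h ∅ (Set.empty_subset _) ?_)
  rw [Set.ncard_empty]
  omega

theorem isFaultTolerant_one_pair_iff {V : Type*} {G : SimpleGraph V} {a b : V} (hab : a ≠ b) :
    IsFaultTolerant G 1 {a, b} ↔ IsZeroForcingSet G {a} ∧ IsZeroForcingSet G {b} := by
  simp only [IsFaultTolerant, Set.ncard_pair hab]
  constructor
  · intro h
    exact ⟨h _ (by simp) (by simp), h _ (by simp) (by simp)⟩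
  · rintro ⟨ha, hb⟩ F hF hcard
    obtain ⟨c, rfl⟩ := Set.ncard_eq_one.1 hcard
    rcases hF rfl with rfl | rfl
    · exact ha
    · exact hb

theorem isFaultTolerant_one_pathGraph_endpoints {n : ℕ} {a b : Fin n} (hab : a ≠ b)
    (ha : a.val = 0) (hb : b.val + 1 = n) : IsFaultTolerant (pathGraph n) 1 {a, b} :=
  (isFaultTolerant_one_pair_iff hab).2
    ⟨(isZeroForcingSet_pathGraph_singleton_iff a).2 (Or.inl ha),
      (isZeroForcingSet_pathGraph_singleton_iff b).2 (Or.inr hb)⟩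

theorem faultPropTime_pathGraph {n : ℕ} {B : Set (Fin n)} (hB : B.ncard = 2)
    (h : IsFaultTolerant (pathGraph n) 1 B) : faultPropTime (pathGraph n) B = n - 1 := by
  obtain ⟨a, b, hab, rfl⟩ := Set.ncard_eq_two.1 hB
  obtain ⟨ha, hb⟩ := (isFaultTolerant_one_pair_iff hab).1 h
  have hda : ({a, b} : Set (Fin n)) \ {a} = {b} := by
    ext v; simp only [Set.mem_sdiff, Set.mem_insert_iff, Set.mem_singleton_iff]; grind
  have hdb : ({a, b} : Set (Fin n)) \ {b} = {a} := by
    ext v; simp only [Set.mem_sdiff, Set.mem_insert_iff, Set.mem_singleton_iff]; grind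
  simp [faultPropTime, hda, hdb, propTime_pathGraph_singleton ha, propTime_pathGraph_singleton hb]

theorem stmt16 (n : ℕ) (hn : 2 ≤ n) :
    faultPropTimeGraph (SimpleGraph.pathGraph n) = n - 1 := by
  have : Nonempty (Fin n) := ⟨⟨0, by omega⟩⟩
  obtain ⟨B, hB, hcard⟩ : ∃ B, IsFaultTolerant (pathGraph n) 1 B ∧ B.ncard = 2 := by
    have hab : (⟨0, by omega⟩ : Fin n) ≠ ⟨n - 1, by omega⟩ := by
      simp only [ne_eq, Fin.ext_iff]
      omega
    exact ⟨_, isFaultTolerant_one_pathGraph_endpoints hab rfl (by simp only; omega),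
      Set.ncard_pair hab⟩
  have hZ : ftZeroForcingNumber (pathGraph n) 1 = 2 := by
    refine IsLeast.csInf_eq ⟨⟨B, hB, hcard⟩, ?_⟩
    rintro m ⟨C, hC, rfl⟩
    exact two_le_ncard_of_isFaultTolerant_one hC
  refine IsLeast.csInf_eq ⟨⟨B, hB, hcard.trans hZ.symm, (faultPropTime_pathGraph hcard hB).symm⟩,
    ?_⟩
  rintro t ⟨C, hC, hCcard, rfl⟩
  exact (faultPropTime_pathGraph (hCcard.trans hZ) hC).ge
end

section
/- For the cycle graph C_n on n ≥ 4 vertices, the fault propagation time satisfies fpt(C_n) = ⌈(n − 3)/2⌉. -/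
open SimpleGraph

section CycleZeroForcing

open scoped Fin.CommRing

variable {m : ℕ}

/-- The set of `l` consecutive vertices of the cycle starting at `x`. -/
def cycleArc (x : Fin (m + 4)) (l : ℕ) : Set (Fin (m + 4)) :=
  (fun j : ℕ => x + (j : Fin (m + 4))) '' Set.Iio l

lemma cycleArc_ncard_le (x : Fin (m + 4)) (l : ℕ) : (cycleArc x l).ncard ≤ l := by
  have h := Set.ncard_image_le (s := Set.Iio l) (Set.finite_Iio l)
    (f := fun j : ℕ => x + (j : Fin (m + 4)))
  have h' : (Set.Iio l).ncard = l := by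
    rw [← Finset.coe_Iio, Set.ncard_coe_finset, Nat.card_Iio]
  rwa [h'] at h

lemma cycleArc_eq_univ (x : Fin (m + 4)) {l : ℕ} (h : m + 4 ≤ l) :
    cycleArc x l = Set.univ := by
  refine Set.eq_univ_of_forall fun y => ⟨(y - x).val, ?_, ?_⟩
  · exact lt_of_lt_of_le (y - x).isLt h
  · simp

lemma cycleArc_widen {x y : Fin (m + 4)} {l : ℕ} (h : y ∈ cycleArc x l) :
    y - 1 ∈ cycleArc (x - 1) (l + 2) ∧ y ∈ cycleArc (x - 1) (l + 2) ∧
      y + 1 ∈ cycleArc (x - 1) (l + 2) := by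
  obtain ⟨j, hj, rfl⟩ := h
  rw [Set.mem_Iio] at hj
  refine ⟨⟨j, ?_, ?_⟩, ⟨j + 1, ?_, ?_⟩, ⟨j + 2, ?_, ?_⟩⟩
  any_goals (rw [Set.mem_Iio]; omega)
  all_goals (push_cast; ring)

lemma fin_numeral_ne_zero :
    (1 : Fin (m + 4)) ≠ 0 ∧ (2 : Fin (m + 4)) ≠ 0 ∧ (3 : Fin (m + 4)) ≠ 0 := by
  refine ⟨?_, ?_, ?_⟩ <;>
  · rw [Ne, Fin.ext_iff]
    simp [Nat.mod_eq_of_lt]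

lemma cycleGraph_adj_iff {u v : Fin (m + 4)} :
    (cycleGraph (m + 4)).Adj u v ↔ v = u + 1 ∨ v = u - 1 := by
  rw [cycleGraph_adj]
  constructor
  · rintro (h | h)
    · right; rw [← h]; ring
    · left; rw [← h]; ring
  · rintro (rfl | rfl)
    · right; ring
    · left; ring

lemma mem_zfStep_of_mem_pair {S : Set (Fin (m + 4))} {a : Fin (m + 4)} (h₀ : a ∈ S)
    (h₁ : a + 1 ∈ S) :
    a - 1 ∈ zfStep (cycleGraph (m + 4)) S ∧ a + 2 ∈ zfStep (cycleGraph (m + 4)) S := by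
  constructor
  · refine Or.inr ⟨a, h₀, cycleGraph_adj_iff.2 (Or.inr rfl), fun w hw hwS => ?_⟩
    rcases cycleGraph_adj_iff.1 hw with rfl | rfl
    · exact absurd h₁ hwS
    · rfl
  · refine Or.inr ⟨a + 1, h₁, cycleGraph_adj_iff.2 (Or.inl (by ring)), fun w hw hwS => ?_⟩
    rcases cycleGraph_adj_iff.1 hw with rfl | rfl
    · ring
    · exact absurd (by simpa using h₀) hwS

lemma cycleArc_subset_zfStep {S : Set (Fin (m + 4))} {x : Fin (m + 4)} {l : ℕ} (hl : 2 ≤ l)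
    (h : cycleArc x l ⊆ S) :
    cycleArc (x - 1) (l + 2) ⊆ zfStep (cycleGraph (m + 4)) S := by
  have hmem : ∀ j < l, x + (j : Fin (m + 4)) ∈ S := fun j hj => h ⟨j, hj, rfl⟩
  rintro _ ⟨j, hj, rfl⟩
  rw [Set.mem_Iio] at hj
  rcases Nat.eq_zero_or_pos j with rfl | hj0
  · have := (mem_zfStep_of_mem_pair (a := x) (by simpa using hmem 0 (by omega))
      (by simpa using hmem 1 (by omega))).1
    simpa using this
  obtain ⟨i, rfl⟩ : ∃ i, j = i + 1 := ⟨j - 1, by omega⟩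
  by_cases hi : i < l
  · left
    convert hmem i hi using 1
    push_cast; ring
  · obtain ⟨p, rfl⟩ : ∃ p, l = p + 2 := ⟨l - 2, by omega⟩
    obtain rfl : i = p + 2 := by omega
    have h₁ := hmem (p + 1) (by omega)
    push_cast at h₁
    have := (mem_zfStep_of_mem_pair (a := x + (p : Fin (m + 4))) (hmem p (by omega))
      (by rwa [add_assoc])).2
    convert this using 1
    push_cast; ring

lemma exists_cycleArc_subset_iterate {S : Set (Fin (m + 4))} {x : Fin (m + 4)} {l : ℕ}
    (hl : 2 ≤ l) (h : cycleArc x l ⊆ S) (k : ℕ) :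
    ∃ y, cycleArc y (l + 2 * k) ⊆ (zfStep (cycleGraph (m + 4)))^[k] S := by
  induction k with
  | zero => exact ⟨x, h⟩
  | succ k ih =>
    obtain ⟨y, hy⟩ := ih
    rw [Function.iterate_succ_apply']
    exact ⟨y - 1, cycleArc_subset_zfStep (hl.trans (Nat.le_add_right _ _)) hy⟩

lemma zfStep_subset_cycleArc {S : Set (Fin (m + 4))} {x c : Fin (m + 4)} {l : ℕ}
    (h : S ⊆ cycleArc x l ∪ {c}) :
    ∃ y d, zfStep (cycleGraph (m + 4)) S ⊆ cycleArc y (l + 2) ∪ {d} := by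
  obtain ⟨h1, h2, -⟩ := fin_numeral_ne_zero (m := m)
  have hne : c - 1 ≠ c + 1 := fun e => h2 (by linear_combination -e)
  have harc : ∀ b ∈ cycleArc x l, ∀ w, (cycleGraph (m + 4)).Adj b w →
      w ∈ cycleArc (x - 1) (l + 2) := by
    intro b hb w hw
    rcases cycleGraph_adj_iff.1 hw with rfl | rfl
    · exact (cycleArc_widen hb).2.2
    · exact (cycleArc_widen hb).1
  by_cases hl : c - 1 ∈ cycleArc x l
  · have hw := cycleArc_widen hl
    refine ⟨x - 1, c + 1, ?_⟩
    rintro w (hwS | ⟨b, hb, hbw, -⟩)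
    · rcases h hwS with hw' | rfl
      · exact Or.inl (cycleArc_widen hw').2.1
      · left; simpa using hw.2.2
    · rcases h hb with hb' | rfl
      · exact Or.inl (harc b hb' w hbw)
      · rcases cycleGraph_adj_iff.1 hbw with rfl | rfl
        · exact Or.inr rfl
        · exact Or.inl hw.2.1
  by_cases hr : c + 1 ∈ cycleArc x l
  · have hw := cycleArc_widen hr
    refine ⟨x - 1, c - 1, ?_⟩
    rintro w (hwS | ⟨b, hb, hbw, -⟩)
    · rcases h hwS with hw' | rfl
      · exact Or.inl (cycleArc_widen hw').2.1
      · left; simpa using hw.1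
    · rcases h hb with hb' | rfl
      · exact Or.inl (harc b hb' w hbw)
      · rcases cycleGraph_adj_iff.1 hbw with rfl | rfl
        · exact Or.inl hw.2.1
        · exact Or.inr rfl
  refine ⟨x - 1, c, ?_⟩
  rintro w (hwS | ⟨b, hb, hbw, huniq⟩)
  · rcases h hwS with hw' | rfl
    · exact Or.inl (cycleArc_widen hw').2.1
    · exact Or.inr rfl
  · rcases h hb with hb' | rfl
    · exact Or.inl (harc b hb' w hbw)
    · have hpS : b + 1 ∉ S := fun hS => by
        rcases h hS with h' | h'
        · exact hr h'
        · exact h1 (by linear_combination (Set.mem_singleton_iff.1 h'))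
      have hmS : b - 1 ∉ S := fun hS => by
        rcases h hS with h' | h'
        · exact hl h'
        · exact h1 (by linear_combination -(Set.mem_singleton_iff.1 h'))
      exact absurd ((huniq _ (cycleGraph_adj_iff.2 (Or.inr rfl)) hmS).trans
        (huniq _ (cycleGraph_adj_iff.2 (Or.inl rfl)) hpS).symm) hne

lemma iterate_zfStep_subset_cycleArc {S : Set (Fin (m + 4))} {x c : Fin (m + 4)} {l : ℕ}
    (h : S ⊆ cycleArc x l ∪ {c}) (k : ℕ) :
    ∃ y d, (zfStep (cycleGraph (m + 4)))^[k] S ⊆ cycleArc y (l + 2 * k) ∪ {d} := by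
  induction k with
  | zero => exact ⟨x, c, h⟩
  | succ k ih =>
    obtain ⟨y, d, hy⟩ := ih
    rw [Function.iterate_succ_apply']
    exact zfStep_subset_cycleArc hy

lemma IsZeroForcingSet.exists_mem_pair {F : Set (Fin (m + 4))}
    (hF : IsZeroForcingSet (cycleGraph (m + 4)) F) (hcard : F.ncard ≤ 3) :
    ∃ a ∈ F, a + 1 ∈ F := by
  by_contra! hno
  obtain ⟨-, h2, -⟩ := fin_numeral_ne_zero (m := m)
  have hfix : zfStep (cycleGraph (m + 4)) F = F := by
    refine Set.union_eq_self_of_subset_right ?_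
    rintro w ⟨b, hb, -, huniq⟩
    have hp := huniq _ (cycleGraph_adj_iff.2 (Or.inl rfl)) (hno b hb)
    have hm := huniq (b - 1) (cycleGraph_adj_iff.2 (Or.inr rfl))
      (fun h => hno _ h (by simpa using hb))
    exact absurd (by linear_combination hp - hm) h2
  obtain ⟨k, hk⟩ := hF
  rw [Function.iterate_fixed hfix] at hk
  rw [hk, Set.ncard_univ, Nat.card_eq_fintype_card, Fintype.card_fin] at hcard
  omega

lemma le_of_iterate_zfStep_eq_univ {F : Set (Fin (m + 4))} (hcard : F.ncard ≤ 3) {k : ℕ}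
    (hk : (zfStep (cycleGraph (m + 4)))^[k] F = Set.univ) : m + 1 ≤ 2 * k := by
  obtain ⟨a, ha, ha'⟩ := IsZeroForcingSet.exists_mem_pair ⟨k, hk⟩ hcard
  obtain ⟨h1, -, -⟩ := fin_numeral_ne_zero (m := m)
  have hne : a ≠ a + 1 := fun e => h1 (by linear_combination -e)
  have hrest : (F \ {a, a + 1}).ncard ≤ 1 := by
    have hd := Set.ncard_sdiff (s := {a, a + 1}) (t := F) (by
      rintro _ (rfl | rfl) <;> assumption)
    rw [Set.ncard_pair hne] at hd
    omega
  obtain ⟨c, hc⟩ := (Set.ncard_le_one_iff_subset_singleton (Set.toFinite _)).1 hrest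
  have hsub : F ⊆ cycleArc a 2 ∪ {c} := by
    intro y hy
    by_cases hy' : y ∈ ({a, a + 1} : Set (Fin (m + 4)))
    · left
      rcases hy' with rfl | rfl
      · exact ⟨0, by simp, by simp⟩
      · exact ⟨1, by simp, by simp⟩
    · exact Or.inr (hc ⟨hy, hy'⟩)
  obtain ⟨y, d, hyd⟩ := iterate_zfStep_subset_cycleArc hsub k
  rw [hk] at hyd
  have hcount := (Set.ncard_le_ncard hyd).trans (Set.ncard_union_le _ _)
  rw [Set.ncard_univ, Nat.card_eq_fintype_card, Fintype.card_fin, Set.ncard_singleton] at hcount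
  have := cycleArc_ncard_le y (2 + 2 * k)
  omega

lemma IsFaultTolerant.four_le_ncard {B : Set (Fin (m + 4))}
    (hB : IsFaultTolerant (cycleGraph (m + 4)) 1 B) : 4 ≤ B.ncard := by
  by_contra! hlt
  obtain ⟨h1, h2, h3⟩ := fin_numeral_ne_zero (m := m)
  have hrem : ∀ b ∈ B, ∃ a ∈ B \ {b}, a + 1 ∈ B \ {b} := fun b hb =>
    (hB _ Set.sdiff_subset (Set.ncard_sdiff_singleton_of_mem hb)).exists_mem_pair
      ((Set.ncard_le_ncard Set.sdiff_subset).trans (by omega))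
  have hsmall : ∀ T : Finset (Fin (m + 4)), (T : Set (Fin (m + 4))) ⊆ B → T.card ≤ 3 := by
    intro T hT
    have := Set.ncard_le_ncard hT
    rw [Set.ncard_coe_finset] at this
    omega
  obtain ⟨b₀, hb₀⟩ : B.Nonempty := by
    rw [Set.nonempty_iff_ne_empty]
    rintro rfl
    obtain ⟨a, ha, -⟩ := (hB ∅ subset_rfl (by simp)).exists_mem_pair (by simp)
    exact ha
  obtain ⟨a, ⟨ha, -⟩, ⟨ha', -⟩⟩ := hrem b₀ hb₀
  obtain ⟨p, ⟨hp, hpa⟩, ⟨hp', hpa'⟩⟩ := hrem a ha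
  obtain ⟨q, ⟨hq, hqa⟩, ⟨hq', hqa'⟩⟩ := hrem (a + 1) ha'
  rw [Set.mem_singleton_iff] at hpa hpa' hqa hqa'
  have haa : a ≠ a + 1 := fun e => h1 (by linear_combination -e)
  have hpp : p ≠ p + 1 := fun e => h1 (by linear_combination -e)
  have hap : a + 1 ≠ p + 1 := fun e => hpa (by linear_combination -e)
  have key : ∀ w x y z : Fin (m + 4), w ∈ B → x ∈ B → y ∈ B → z ∈ B → w ≠ x → w ≠ y → w ≠ z →
      x ≠ y → x ≠ z → y ≠ z → False := by
    intro w x y z hw hx hy hz h₁ h₂ h₃ h₄ h₅ h₆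
    have := hsmall {w, x, y, z} (by
      intro u hu
      simp only [Finset.coe_insert, Finset.coe_singleton, Set.mem_insert_iff,
        Set.mem_singleton_iff] at hu
      rcases hu with rfl | rfl | rfl | rfl <;> assumption)
    rw [Finset.card_insert_of_notMem (by simp [*]), Finset.card_insert_of_notMem (by simp [*]),
      Finset.card_pair h₆] at this
    omega
  by_cases hpe : p = a + 1
  · subst hpe
    have hqa0 : q ≠ a := fun e => hqa' (by rw [e])
    have hqa2 : q = a + 1 + 1 := by
      by_contra hne
      exact key a (a + 1) (a + 1 + 1) q ha ha' hp' hq haa (Ne.symm hpa') (Ne.symm hqa0) hpp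
        (Ne.symm hqa) (Ne.symm hne)
    subst hqa2
    exact key a (a + 1) (a + 1 + 1) (a + 1 + 1 + 1) ha ha' hp' hq' haa (Ne.symm hpa')
      (fun e => h3 (by linear_combination -e)) hpp (Ne.symm hqa')
      (fun e => h1 (by linear_combination -e))
  · exact key a (a + 1) p (p + 1) ha ha' hp hp' haa (Ne.symm hpa) (Ne.symm hpa')
      (Ne.symm hpe) hap hpp

lemma iterate_zfStep_cycleArc_sdiff {b : Fin (m + 4)} (hb : b ∈ cycleArc (0 : Fin (m + 4)) 4) :
    (zfStep (cycleGraph (m + 4)))^[(m + 2) / 2] (cycleArc 0 4 \ {b}) = Set.univ := by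
  obtain ⟨h1, h2, h3⟩ := fin_numeral_ne_zero (m := m)
  have hmem : ∀ i : ℕ, i < 4 → (i : Fin (m + 4)) ≠ b → (i : Fin (m + 4)) ∈ cycleArc 0 4 \ {b} :=
    fun (i : ℕ) hi hib => ⟨⟨i, hi, by simp⟩, hib⟩
  have hfirst : ∃ x, cycleArc x 5 ⊆ zfStep (cycleGraph (m + 4)) (cycleArc 0 4 \ {b}) := by
    obtain ⟨j, hj, rfl⟩ := hb
    rw [Set.mem_Iio] at hj
    simp only [zero_add] at hmem ⊢
    have n01 : (0 : Fin (m + 4)) ≠ 1 := fun e => h1 (by linear_combination -e)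
    have n02 : (0 : Fin (m + 4)) ≠ 2 := fun e => h2 (by linear_combination -e)
    have n03 : (0 : Fin (m + 4)) ≠ 3 := fun e => h3 (by linear_combination -e)
    have n12 : (1 : Fin (m + 4)) ≠ 2 := fun e => h1 (by linear_combination -e)
    have n13 : (1 : Fin (m + 4)) ≠ 3 := fun e => h2 (by linear_combination -e)
    have n23 : (2 : Fin (m + 4)) ≠ 3 := fun e => h1 (by linear_combination -e)
    have m0 := hmem 0 (by omega)
    have m1 := hmem 1 (by omega)
    have m2 := hmem 2 (by omega)
    have m3 := hmem 3 (by omega)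
    push_cast at m0 m1 m2 m3
    interval_cases j <;> push_cast at m0 m1 m2 m3 ⊢
    · have p := m1 n01.symm
      have q := m2 n02.symm
      have r := m3 n03.symm
      have f := mem_zfStep_of_mem_pair p (by convert q using 1; ring)
      have g := mem_zfStep_of_mem_pair q (by convert r using 1; ring)
      refine ⟨0, ?_⟩
      rintro _ ⟨i, hi, rfl⟩
      rw [Set.mem_Iio] at hi
      interval_cases i
      · convert f.1 using 1; push_cast; ring
      · left; simpa using p
      · left; simpa using q
      · left; simpa using r
      · convert g.2 using 1; push_cast; ring
    · have p := m0 n01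
      have q := m2 n12.symm
      have r := m3 n13.symm
      have g := mem_zfStep_of_mem_pair q (by convert r using 1; ring)
      refine ⟨0, ?_⟩
      rintro _ ⟨i, hi, rfl⟩
      rw [Set.mem_Iio] at hi
      interval_cases i
      · left; simpa using p
      · convert g.1 using 1; push_cast; ring
      · left; simpa using q
      · left; simpa using r
      · convert g.2 using 1; push_cast; ring
    · have p := m0 n02
      have q := m1 n12
      have r := m3 n23.symm
      have g := mem_zfStep_of_mem_pair p (by convert q using 1; ring)
      refine ⟨-1, ?_⟩
      rintro _ ⟨i, hi, rfl⟩
      rw [Set.mem_Iio] at hi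
      interval_cases i
      · convert g.1 using 1; push_cast; ring
      · left; convert p using 1; push_cast; ring
      · left; convert q using 1; push_cast; ring
      · convert g.2 using 1; push_cast; ring
      · left; convert r using 1; push_cast; ring
    · have p := m0 n03
      have q := m1 n13
      have r := m2 n23
      have f := mem_zfStep_of_mem_pair p (by convert q using 1; ring)
      have g := mem_zfStep_of_mem_pair q (by convert r using 1; ring)
      refine ⟨-1, ?_⟩
      rintro _ ⟨i, hi, rfl⟩
      rw [Set.mem_Iio] at hi
      interval_cases i
      · convert f.1 using 1; push_cast; ring
      · left; convert p using 1; push_cast; ring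
      · left; convert q using 1; push_cast; ring
      · left; convert r using 1; push_cast; ring
      · convert g.2 using 1; push_cast; ring
  obtain ⟨x, hx⟩ := hfirst
  obtain ⟨k, hk⟩ : ∃ k, (m + 2) / 2 = k + 1 := ⟨(m + 2) / 2 - 1, by omega⟩
  rw [hk, Function.iterate_succ_apply]
  obtain ⟨y, hy⟩ := exists_cycleArc_subset_iterate (by omega) hx k
  rw [cycleArc_eq_univ y (by omega)] at hy
  exact Set.univ_subset_iff.1 hy

lemma isFaultTolerant_cycleArc :
    IsFaultTolerant (cycleGraph (m + 4)) 1 (cycleArc (0 : Fin (m + 4)) 4) := by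
  have hne : (cycleArc (0 : Fin (m + 4)) 4).Nonempty := ⟨_, 0, by simp, rfl⟩
  intro F hF hcard
  have hpos := hne.ncard_pos
  have hss : F ⊂ cycleArc 0 4 := hF.ssubset_of_ne (by rintro rfl; omega)
  obtain ⟨b, hb, hbF⟩ := Set.exists_of_ssubset hss
  have hFb : F = cycleArc 0 4 \ {b} :=
    Set.eq_of_subset_of_ncard_le (fun y hy => ⟨hF hy, by rintro rfl; exact hbF hy⟩)
      (by rw [Set.ncard_sdiff_singleton_of_mem hb]; omega)
  exact ⟨_, hFb ▸ iterate_zfStep_cycleArc_sdiff hb⟩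

lemma ncard_cycleArc_four : (cycleArc (0 : Fin (m + 4)) 4).ncard = 4 :=
  le_antisymm (cycleArc_ncard_le _ _) isFaultTolerant_cycleArc.four_le_ncard

lemma ftZeroForcingNumber_cycleGraph : ftZeroForcingNumber (cycleGraph (m + 4)) 1 = 4 := by
  refine IsLeast.csInf_eq ⟨⟨_, isFaultTolerant_cycleArc, ncard_cycleArc_four⟩, ?_⟩
  rintro _ ⟨B, hB, rfl⟩
  exact hB.four_le_ncard

lemma faultPropTime_cycleArc_le :
    faultPropTime (cycleGraph (m + 4)) (cycleArc 0 4) ≤ (m + 2) / 2 := by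
  refine csSup_le' ?_
  rintro _ ⟨b, hb, rfl⟩
  exact Nat.sInf_le (iterate_zfStep_cycleArc_sdiff hb)

lemma IsFaultTolerant.le_faultPropTime {B : Set (Fin (m + 4))}
    (hB : IsFaultTolerant (cycleGraph (m + 4)) 1 B) (hcard : B.ncard = 4) :
    (m + 2) / 2 ≤ faultPropTime (cycleGraph (m + 4)) B := by
  obtain ⟨b, hb⟩ : B.Nonempty := Set.nonempty_of_ncard_ne_zero (by omega)
  have hrem := Set.ncard_sdiff_singleton_of_mem hb
  have hzf := hB _ Set.sdiff_subset hrem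
  have hle : m + 1 ≤ 2 * propTime (cycleGraph (m + 4)) (B \ {b}) :=
    le_of_iterate_zfStep_eq_univ (by omega) (Nat.sInf_mem hzf)
  have hbdd : BddAbove {t : ℕ | ∃ b ∈ B, t = propTime (cycleGraph (m + 4)) (B \ {b})} := by
    refine Set.Finite.bddAbove ((B.toFinite.image
      fun b => propTime (cycleGraph (m + 4)) (B \ {b})).subset ?_)
    rintro _ ⟨b, hb, rfl⟩
    exact ⟨b, hb, rfl⟩
  refine le_trans ?_ (le_csSup hbdd ⟨b, hb, rfl⟩)
  omega

end CycleZeroForcing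

theorem stmt17 (n : ℕ) (hn : 4 ≤ n) :
    faultPropTimeGraph (SimpleGraph.cycleGraph n) = (n - 3 + 1) / 2 := by
  obtain ⟨m, rfl⟩ : ∃ m, n = m + 4 := ⟨n - 4, by omega⟩
  rw [show m + 4 - 3 + 1 = m + 2 by omega]
  have hmem := (isFaultTolerant_cycleArc (m := m)).le_faultPropTime ncard_cycleArc_four
  refine IsLeast.csInf_eq ⟨⟨_, isFaultTolerant_cycleArc, ?_,
    le_antisymm hmem faultPropTime_cycleArc_le⟩, ?_⟩
  · rw [ftZeroForcingNumber_cycleGraph, ncard_cycleArc_four]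
  · rintro _ ⟨B, hB, hcard, rfl⟩
    exact hB.le_faultPropTime (hcard.trans ftZeroForcingNumber_cycleGraph)
end
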